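/- Let C142, C143, C144, C244 be real numbers with C144 ≠ 0 and let g be the Lie algebra ourSolDep[3] on the basis y1, y2, y3, y4 with brackets [y1,y2]=y3, [y1,y3]=y4, [y1,y4]=−(C142·C244/C144)·y1 + C142·y2 + C143·y3 + C144·y4, [y2,y3]=(C244/C144)·y4, [y2,y4]=(C244/C144²)·(−C142·C244·y1 + C142·C144·y2 + C143·C144·y3 + C144²·y4), [y3,y4]=0. Let D = span{y1,y2}, so that D[2] := D + [D,D] = span{y1,y2,y3}, and let L = span{C244·y1 − C144·y2}. Then L ⊆ D and [L, D[2]] ⊆ D[2], i.e. L is a characteristic line of the Engel-like structure D. -/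

import Mathlib

/-- Bilinear extension of structure constants `c` to a bracket on `Fin 4 → ℝ`. -/
noncomputable def bk (c : Fin 4 → Fin 4 → Fin 4 → ℝ) (x y : Fin 4 → ℝ) : Fin 4 → ℝ :=
  ∑ i : Fin 4, ∑ j : Fin 4, (x i * y j) • c i j

/-- Structure constants of the Engel-normalized bracket:
`[y1,y2] = y3`, `[y1,y3] = y4`, `[y1,y4] = C14`, `[y2,y3] = C23`,
`[y2,y4] = C24`, `[y3,y4] = C34`, extended skew-symmetrically. -/
noncomputable def sc (C14 C23 C24 C34 : Fin 4 → ℝ) : Fin 4 → Fin 4 → Fin 4 → ℝ :=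
  ![![0, ![0, 0, 1, 0], ![0, 0, 0, 1], C14],
    ![-![0, 0, 1, 0], 0, C23, C24],
    ![-![0, 0, 0, 1], -C23, 0, C34],
    ![-C14, -C24, -C34, 0]]

/-- The subspace spanned by all brackets `B u v` with `u ∈ S`, `v ∈ T`. -/
noncomputable def brS (B : (Fin 4 → ℝ) → (Fin 4 → ℝ) → (Fin 4 → ℝ))
    (S T : Submodule ℝ (Fin 4 → ℝ)) : Submodule ℝ (Fin 4 → ℝ) :=
  Submodule.span ℝ {z | ∃ u ∈ S, ∃ v ∈ T, z = B u v}

/-- `D` is an Engel-like structure for the bracket `B`: `D` is 2-dimensional,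
`D[2] = D + [D,D]` is 3-dimensional and `D[3] = D[2] + [D[2],D[2]]` is 4-dimensional. -/
noncomputable def IsEngelLike (B : (Fin 4 → ℝ) → (Fin 4 → ℝ) → (Fin 4 → ℝ))
    (D : Submodule ℝ (Fin 4 → ℝ)) : Prop :=
  Module.finrank ℝ D = 2 ∧
  Module.finrank ℝ ↥(D ⊔ brS B D D) = 3 ∧
  Module.finrank ℝ ↥((D ⊔ brS B D D) ⊔ brS B (D ⊔ brS B D D) (D ⊔ brS B D D)) = 4

theorem memD_iff (x : Fin 4 → ℝ) :
    x ∈ Submodule.span ℝ {(![1, 0, 0, 0] : Fin 4 → ℝ), ![0, 1, 0, 0]} ↔ x 2 = 0 ∧ x 3 = 0 := by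
  rw [Submodule.mem_span_pair]
  constructor
  · rintro ⟨a, b, rfl⟩
    simp
  · rintro ⟨h2, h3⟩
    refine ⟨x 0, x 1, ?_⟩
    ext i
    fin_cases i <;> simp [h2, h3]

theorem memE_iff (x : Fin 4 → ℝ) :
    x ∈ Submodule.span ℝ {(![1, 0, 0, 0] : Fin 4 → ℝ), ![0, 1, 0, 0], ![0, 0, 1, 0]} ↔
      x 3 = 0 := by
  rw [Submodule.mem_span_triple]
  constructor
  · rintro ⟨a, b, c, rfl⟩
    simp
  · intro h3
    refine ⟨x 0, x 1, x 2, ?_⟩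
    ext i
    fin_cases i <;> simp [h3]

theorem ourSolDep3_characteristic_line (C142 C143 C144 C244 : ℝ)
    (hC144 : C144 ≠ 0) :
    let B := bk (sc ![-(C142 * C244 / C144), C142, C143, C144]
      ![0, 0, 0, C244 / C144]
      ![(C244 / C144 ^ 2) * (-C142 * C244), (C244 / C144 ^ 2) * (C142 * C144),
        (C244 / C144 ^ 2) * (C143 * C144), (C244 / C144 ^ 2) * C144 ^ 2]
      ![0, 0, 0, 0])
    let D := Submodule.span ℝ {(![1, 0, 0, 0] : Fin 4 → ℝ), ![0, 1, 0, 0]}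
    let D2 := D ⊔ brS B D D
    let Lc := Submodule.span ℝ {(![C244, -C144, 0, 0] : Fin 4 → ℝ)}
    D2 = Submodule.span ℝ {(![1, 0, 0, 0] : Fin 4 → ℝ), ![0, 1, 0, 0], ![0, 0, 1, 0]} ∧
    Module.finrank ℝ Lc = 1 ∧ Lc ≤ D ∧ brS B Lc D2 ≤ D2 := by
  intro B D D2 Lc
  have hD2 : D2 = Submodule.span ℝ
      {(![1, 0, 0, 0] : Fin 4 → ℝ), ![0, 1, 0, 0], ![0, 0, 1, 0]} := by
    apply le_antisymm
    · refine sup_le ?_ ?_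
      · intro x hx
        rw [memE_iff]
        exact ((memD_iff x).1 hx).2
      · refine Submodule.span_le.2 ?_
        rintro z ⟨u, hu, v, hv, rfl⟩
        obtain ⟨hu2, hu3⟩ := (memD_iff u).1 hu
        obtain ⟨hv2, hv3⟩ := (memD_iff v).1 hv
        rw [SetLike.mem_coe, memE_iff]
        simp [B, bk, sc, Fin.sum_univ_four, hu2, hu3, hv2, hv3]
    · refine Submodule.span_le.2 ?_
      have h1 : (![1, 0, 0, 0] : Fin 4 → ℝ) ∈ D := (memD_iff _).2 (by simp)
      have h2 : (![0, 1, 0, 0] : Fin 4 → ℝ) ∈ D := (memD_iff _).2 (by simp)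
      rintro z (rfl | rfl | rfl)
      · exact (le_sup_left : D ≤ D2) h1
      · exact (le_sup_left : D ≤ D2) h2
      · refine (le_sup_right : brS B D D ≤ D2) (Submodule.subset_span ⟨_, h1, _, h2, ?_⟩)
        ext i
        fin_cases i <;> simp [B, bk, sc, Fin.sum_univ_four]
  refine ⟨hD2, ?_, ?_, ?_⟩
  · apply finrank_span_singleton
    intro h
    apply hC144
    simpa using congrFun h 1
  · refine Submodule.span_le.2 ?_
    rintro z rfl
    exact (memD_iff _).2 (by simp)
  · refine Submodule.span_le.2 ?_
    rintro z ⟨u, hu, v, hv, rfl⟩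
    rw [hD2, memE_iff] at hv
    obtain ⟨a, rfl⟩ := Submodule.mem_span_singleton.1 hu
    rw [SetLike.mem_coe, hD2, memE_iff]
    simp [B, bk, sc, Fin.sum_univ_four, hv]
    field_simp
    try ring
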